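/- For every real constant c > 0, the sequence H_n = Γ(n − c) · n^c / Γ(n) is nonincreasing in n on integers n > c; in particular, for every integer N > c, sup_{n ≥ N} H_n = H_N. -/

import Mathlib

theorem sub_mul_add_one_rpow_le {x c : ℝ} (hx : 0 < x) (hc : 0 ≤ c) :
    (x - c) * (x + 1) ^ c ≤ x * x ^ c := by
  have hpow : (1 + 1 / x) ^ c ≤ Real.exp (c / x) := by
    calc (1 + 1 / x) ^ c ≤ Real.exp (1 / x) ^ c := by
          gcongr
          linarith [Real.add_one_le_exp (1 / x)]
      _ = Real.exp (c / x) := by rw [← Real.exp_mul]; congr 1; ring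
  have hlin : 1 - c / x ≤ Real.exp (-(c / x)) := Real.one_sub_le_exp_neg _
  have hprod : (1 - c / x) * (1 + 1 / x) ^ c ≤ 1 := by
    calc (1 - c / x) * (1 + 1 / x) ^ c
        ≤ Real.exp (-(c / x)) * Real.exp (c / x) := by gcongr
      _ = 1 := by rw [← Real.exp_add]; simp
  calc (x - c) * (x + 1) ^ c
      = x * x ^ c * ((1 - c / x) * (1 + 1 / x) ^ c) := by
        have hfactor : x + 1 = x * (1 + 1 / x) := by field_simp
        rw [hfactor, Real.mul_rpow hx.le (by positivity)]
        field_simp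
    _ ≤ x * x ^ c * 1 := by gcongr
    _ = x * x ^ c := mul_one _

theorem Gamma_sub_mul_rpow_div_Gamma_add_one_le {x c : ℝ} (hc : 0 ≤ c) (hx : c < x) :
    Real.Gamma (x + 1 - c) * (x + 1) ^ c / Real.Gamma (x + 1) ≤
      Real.Gamma (x - c) * x ^ c / Real.Gamma x := by
  have hx0 : 0 < x := hc.trans_lt hx
  have hxc : 0 < x - c := sub_pos.2 hx
  have hGx : 0 < Real.Gamma x := Real.Gamma_pos_of_pos hx0
  have hGxc : 0 < Real.Gamma (x - c) := Real.Gamma_pos_of_pos hxc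
  rw [show x + 1 - c = x - c + 1 by ring, Real.Gamma_add_one hxc.ne',
    Real.Gamma_add_one hx0.ne', div_le_div_iff₀ (by positivity) hGx]
  calc (x - c) * Real.Gamma (x - c) * (x + 1) ^ c * Real.Gamma x
      = Real.Gamma (x - c) * Real.Gamma x * ((x - c) * (x + 1) ^ c) := by ring
    _ ≤ Real.Gamma (x - c) * Real.Gamma x * (x * x ^ c) :=
        mul_le_mul_of_nonneg_left (sub_mul_add_one_rpow_le hx0 hc) (by positivity)
    _ = Real.Gamma (x - c) * x ^ c * (x * Real.Gamma x) := by ring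

/-- for every `c > 0`, the sequence `H_n = Γ(n - c) n^c / Γ(n)` is
nonincreasing on integers `n > c`; in particular, for every integer `N > c`,
`sup_{n ≥ N} H_n = H_N`. -/
theorem Hconst_antitone_and_sup (c : ℝ) (hc : 0 < c) :
    (∀ m n : ℕ, c < (m : ℝ) → m ≤ n →
      Real.Gamma ((n : ℝ) - c) * (n : ℝ) ^ c / Real.Gamma (n : ℝ) ≤
        Real.Gamma ((m : ℝ) - c) * (m : ℝ) ^ c / Real.Gamma (m : ℝ)) ∧
    ∀ N : ℕ, c < (N : ℝ) →
      (⨆ n : {n : ℕ // N ≤ n},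
          Real.Gamma (((n : ℕ) : ℝ) - c) * ((n : ℕ) : ℝ) ^ c / Real.Gamma (((n : ℕ) : ℝ))) =
        Real.Gamma ((N : ℝ) - c) * (N : ℝ) ^ c / Real.Gamma (N : ℝ) := by
  have hanti : ∀ m n : ℕ, c < (m : ℝ) → m ≤ n →
      Real.Gamma ((n : ℝ) - c) * (n : ℝ) ^ c / Real.Gamma (n : ℝ) ≤
        Real.Gamma ((m : ℝ) - c) * (m : ℝ) ^ c / Real.Gamma (m : ℝ) := by
    intro m n hm hmn
    induction n, hmn using Nat.le_induction with
    | base => exact le_rfl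
    | succ n hmn ih =>
      have hn : c < (n : ℝ) := hm.trans_le (by exact_mod_cast hmn)
      push_cast
      exact (Gamma_sub_mul_rpow_div_Gamma_add_one_le hc.le hn).trans ih
  refine ⟨hanti, fun N hN => ?_⟩
  refine IsGreatest.csSup_eq ⟨⟨⟨N, le_rfl⟩, rfl⟩, ?_⟩
  rintro _ ⟨⟨n, hn⟩, rfl⟩
  exact hanti N n hN hn
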